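/- arXiv:2206.12940 — 2 statements merged into one kernel-verified Lean document; each statement's English description precedes it below -/
import Mathlib

section
/- Let g be the three-dimensional Heisenberg Lie algebra over ℝ with basis {X, Y, Z} and only nonzero bracket [X, Y] = Z. Then for every nonzero element W ∈ g there exists a Lie algebra automorphism φ of g such that φ(span{W}) = span{Z}, or φ(span{W}) = span{Y}, or φ(span{W}) = span{X + kY} for some k ∈ ℝ. -/
/-- In a Lie algebra that is nilpotent of class at most two, `1 + ad V` is an automorphism. -/
def LieEquiv.oneAddAd {R L : Type*} [CommRing R] [LieRing L] [LieAlgebra R L]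
    (h : ∀ A B C : L, ⁅A, ⁅B, C⁆⁆ = 0) (V : L) : L ≃ₗ⁅R⁆ L where
  toFun U := U + ⁅V, U⁆
  map_add' A B := by rw [lie_add]; abel
  map_smul' r A := by simp
  map_lie' {A B} := by
    have h' : ∀ A B C : L, ⁅⁅B, C⁆, A⁆ = 0 := fun A B C => by
      rw [← lie_skew, h, neg_zero]
    simp [h, h']
  invFun U := U - ⁅V, U⁆
  left_inv U := by simp [h]
  right_inv U := by simp [h]

theorem LieEquiv.oneAddAd_apply {R L : Type*} [CommRing R] [LieRing L] [LieAlgebra R L]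
    (h : ∀ A B C : L, ⁅A, ⁅B, C⁆⁆ = 0) (V U : L) :
    LieEquiv.oneAddAd (R := R) h V U = U + ⁅V, U⁆ := rfl

theorem LieEquiv.map_span_singleton_of_apply_eq_smul {K L : Type*} [Field K] [LieRing L]
    [LieAlgebra K L] (φ : L ≃ₗ⁅K⁆ L) {W T : L} {r : K} (hr : r ≠ 0) (h : φ W = r • T) :
    Submodule.map φ.toLieHom.toLinearMap (Submodule.span K ({W} : Set L)) =
      Submodule.span K ({T} : Set L) := by
  rw [Submodule.map_span, Set.image_singleton]
  change Submodule.span K {φ W} = _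
  rw [h, Submodule.span_singleton_smul_eq hr.isUnit]

/-- In the three-dimensional Heisenberg Lie algebra with basis `{X, Y, Z}`
and only nonzero bracket `[X, Y] = Z`, every one-dimensional subspace is conjugate under
a Lie algebra automorphism to `span{Z}`, `span{Y}`, or `span{X + kY}` for some `k ∈ ℝ`. -/
theorem stmt_15 (L : Type*) [LieRing L] [LieAlgebra ℝ L]
    (X Y Z : L) (hli : LinearIndependent ℝ ![X, Y, Z])
    (hspan : Submodule.span ℝ ({X, Y, Z} : Set L) = ⊤)
    (hXY : ⁅X, Y⁆ = Z) (hXZ : ⁅X, Z⁆ = 0) (hYZ : ⁅Y, Z⁆ = 0) :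
    ∀ W : L, W ≠ 0 → ∃ φ : L ≃ₗ⁅ℝ⁆ L,
      Submodule.map φ.toLieHom.toLinearMap (Submodule.span ℝ ({W} : Set L)) =
          Submodule.span ℝ ({Z} : Set L) ∨
      Submodule.map φ.toLieHom.toLinearMap (Submodule.span ℝ ({W} : Set L)) =
          Submodule.span ℝ ({Y} : Set L) ∨
      ∃ k : ℝ, Submodule.map φ.toLieHom.toLinearMap (Submodule.span ℝ ({W} : Set L)) =
          Submodule.span ℝ ({X + k • Y} : Set L) := by
  have hcoord : ∀ A : L, ∃ a b c : ℝ, a • X + b • Y + c • Z = A := fun A => by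
    have hA : A ∈ Submodule.span ℝ ({X, Y, Z} : Set L) := hspan ▸ Submodule.mem_top
    exact Submodule.mem_span_triple.mp hA
  have hYX : ⁅Y, X⁆ = -Z := by rw [← lie_skew, hXY]
  have hZX : ⁅Z, X⁆ = 0 := by rw [← lie_skew, hXZ, neg_zero]
  have hZY : ⁅Z, Y⁆ = 0 := by rw [← lie_skew, hYZ, neg_zero]
  have hnil : ∀ A B C : L, ⁅A, ⁅B, C⁆⁆ = 0 := fun A B C => by
    obtain ⟨a, b, c, rfl⟩ := hcoord A
    obtain ⟨a', b', c', rfl⟩ := hcoord B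
    obtain ⟨a'', b'', c'', rfl⟩ := hcoord C
    simp [hXY, hXZ, hYZ, hYX, hZX, hZY]
  intro W hW
  obtain ⟨a, b, c, rfl⟩ := hcoord W
  by_cases ha : a = 0
  · subst ha
    by_cases hb : b = 0
    · subst hb
      have hc : c ≠ 0 := by
        rintro rfl
        simp at hW
      exact ⟨LieEquiv.refl, Or.inl (LieEquiv.map_span_singleton_of_apply_eq_smul _ hc (by simp))⟩
    · refine ⟨LieEquiv.oneAddAd hnil ((-(c / b)) • X), Or.inr (Or.inl
        (LieEquiv.map_span_singleton_of_apply_eq_smul _ hb ?_))⟩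
      simp only [LieEquiv.oneAddAd_apply, lie_add, lie_smul, smul_lie, lie_self, hXY, hXZ]
      match_scalars <;> field_simp <;> ring
  · refine ⟨LieEquiv.oneAddAd hnil ((c / a) • Y), Or.inr (Or.inr ⟨b / a,
      LieEquiv.map_span_singleton_of_apply_eq_smul _ ha ?_⟩)⟩
    simp only [LieEquiv.oneAddAd_apply, lie_add, lie_smul, smul_lie, lie_self, hYX, hYZ]
    match_scalars <;> field_simp <;> ring
end

section
/- Let g be the four-dimensional Lie algebra over ℝ with basis {e₁, e₂, e₃, e₄} and nonzero bracket relations [e₁, e₂] = −2e₁, [e₁, e₃] = −e₄, [e₂, e₃] = −3e₃, [e₂, e₄] = −e₄ (all other brackets of basis elements are zero). Then for every nonzero element W ∈ g there exists a Lie algebra automorphism φ of g such that φ(span{W}) is one of span{e₄}, span{e₁}, span{e₃}, span{e₁ + e₃}, span{e₁ − e₃}, span{e₂}. -/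
/-- A linear map which respects the brackets of basis vectors respects all brackets. -/
theorem map_lie_of_basis {ι R L L' : Type*} [CommRing R] [LieRing L] [LieAlgebra R L]
    [LieRing L'] [LieAlgebra R L'] (b : Module.Basis ι R L) (f : L →ₗ[R] L')
    (h : ∀ i j, f ⁅b i, b j⁆ = ⁅f (b i), f (b j)⁆) (x y : L) : f ⁅x, y⁆ = ⁅f x, f y⁆ := by
  have key : (LieModule.toEnd R L L : L →ₗ[R] Module.End R L).compr₂ f =
      (LieModule.toEnd R L' L' : L' →ₗ[R] Module.End R L').compl₁₂ f f :=
    b.ext fun i => b.ext fun j => by simpa using h i j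
  simpa using LinearMap.congr_fun₂ key x y

/-- If a Lie algebra automorphism sends `e` to a nonzero multiple of `W`, then its inverse sends
the line through `W` to the line through `e`. -/
theorem map_symm_span_singleton {K L : Type*} [Field K] [LieRing L] [LieAlgebra K L]
    (ψ : L ≃ₗ⁅K⁆ L) {e W : L} {s : K} (hs : s ≠ 0) (h : ψ e = s • W) :
    Submodule.map ψ.symm.toLieHom.toLinearMap (Submodule.span K ({W} : Set L)) =
      Submodule.span K ({e} : Set L) := by
  have hW : W = ψ (s⁻¹ • e) := by
    have : ψ (s⁻¹ • e) = s⁻¹ • ψ e := map_smul ψ.toLieHom _ _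
    rw [this, h, inv_smul_smul₀ hs]
  have hsymm : ψ.symm.toLieHom.toLinearMap W = s⁻¹ • e := by
    rw [hW]
    exact ψ.symm_apply_apply _
  rw [Submodule.map_span, Set.image_singleton, hsymm]
  exact Submodule.span_singleton_smul_eq (IsUnit.mk0 _ (inv_ne_zero hs)) e

/-- A five-parameter family of automorphisms of the Lie algebra. -/
theorem exists_lieEquiv {L : Type*} [LieRing L] [LieAlgebra ℝ L] (b : Module.Basis (Fin 4) ℝ L)
    (h01 : ⁅b 0, b 1⁆ = (-2 : ℝ) • b 0) (h02 : ⁅b 0, b 2⁆ = -b 3) (h03 : ⁅b 0, b 3⁆ = 0)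
    (h12 : ⁅b 1, b 2⁆ = (-3 : ℝ) • b 2) (h13 : ⁅b 1, b 3⁆ = -b 3) (h23 : ⁅b 2, b 3⁆ = 0)
    {a c : ℝ} (ha : a ≠ 0) (hc : c ≠ 0) (x y z : ℝ) :
    ∃ ψ : L ≃ₗ⁅ℝ⁆ L, ψ (b 0) = a • b 0 + (y * a / 3) • b 3 ∧
      ψ (b 1) = b 1 + x • b 0 + y • b 2 + z • b 3 ∧
      ψ (b 2) = c • b 2 + (x * c / 2) • b 3 ∧ ψ (b 3) = (a * c) • b 3 := by
  have h10 : ⁅b 1, b 0⁆ = (2 : ℝ) • b 0 := by rw [← lie_skew, h01]; module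
  have h20 : ⁅b 2, b 0⁆ = b 3 := by rw [← lie_skew, h02]; module
  have h30 : ⁅b 3, b 0⁆ = 0 := by rw [← lie_skew, h03]; module
  have h21 : ⁅b 2, b 1⁆ = (3 : ℝ) • b 2 := by rw [← lie_skew, h12]; module
  have h31 : ⁅b 3, b 1⁆ = b 3 := by rw [← lie_skew, h13]; module
  have h32 : ⁅b 3, b 2⁆ = 0 := by rw [← lie_skew, h23]; module
  let f : L →ₗ[ℝ] L := b.constr ℝ ![a • b 0 + (y * a / 3) • b 3,
    b 1 + x • b 0 + y • b 2 + z • b 3, c • b 2 + (x * c / 2) • b 3, (a * c) • b 3]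
  have f0 : f (b 0) = a • b 0 + (y * a / 3) • b 3 := b.constr_basis ℝ _ 0
  have f1 : f (b 1) = b 1 + x • b 0 + y • b 2 + z • b 3 := b.constr_basis ℝ _ 1
  have f2 : f (b 2) = c • b 2 + (x * c / 2) • b 3 := b.constr_basis ℝ _ 2
  have f3 : f (b 3) = (a * c) • b 3 := b.constr_basis ℝ _ 3
  have hlie : ∀ u v, f ⁅u, v⁆ = ⁅f u, f v⁆ := by
    refine map_lie_of_basis b f fun i j => ?_
    fin_cases i <;> fin_cases j <;>
      simp [f0, f1, f2, f3, h01, h02, h03, h12, h13, h23, h10, h20, h30, h21, h31, h32] <;>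
      module
  have hsurj : Function.Surjective f := by
    have m0 := LinearMap.mem_range_self f (b 0)
    have m1 := LinearMap.mem_range_self f (b 1)
    have m2 := LinearMap.mem_range_self f (b 2)
    rw [f0] at m0
    rw [f1] at m1
    rw [f2] at m2
    have g3 : b 3 ∈ LinearMap.range f :=
      ⟨(a * c)⁻¹ • b 3, by rw [map_smul, f3, inv_smul_smul₀ (mul_ne_zero ha hc)]⟩
    have g2 : b 2 ∈ LinearMap.range f := by
      have h := Submodule.smul_mem (LinearMap.range f) c⁻¹ (Submodule.sub_mem _ m2
        (Submodule.smul_mem _ (x * c / 2) g3))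
      rwa [add_sub_cancel_right, inv_smul_smul₀ hc] at h
    have g0 : b 0 ∈ LinearMap.range f := by
      have h := Submodule.smul_mem (LinearMap.range f) a⁻¹ (Submodule.sub_mem _ m0
        (Submodule.smul_mem _ (y * a / 3) g3))
      rwa [add_sub_cancel_right, inv_smul_smul₀ ha] at h
    have g1 : b 1 ∈ LinearMap.range f := by
      have h := Submodule.sub_mem _ (Submodule.sub_mem _ (Submodule.sub_mem _ m1
        (Submodule.smul_mem _ z g3)) (Submodule.smul_mem _ y g2)) (Submodule.smul_mem _ x g0)
      rwa [add_sub_cancel_right, add_sub_cancel_right, add_sub_cancel_right] at h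
    rw [← LinearMap.range_eq_top, eq_top_iff, ← b.span_eq, Submodule.span_le]
    rintro _ ⟨i, rfl⟩
    fin_cases i
    exacts [g0, g1, g2, g3]
  have : FiniteDimensional ℝ L := b.finiteDimensional_of_finite
  have hinj : Function.Injective f := LinearMap.injective_iff_surjective.mpr hsurj
  exact ⟨LieEquiv.ofBijective { f with map_lie' := hlie _ _ } ⟨hinj, hsurj⟩, f0, f1, f2, f3⟩

/-- In the four-dimensional Lie algebra with basis `{e₁, e₂, e₃, e₄}` and
nonzero brackets `[e₁,e₂] = −2e₁`, `[e₁,e₃] = −e₄`, `[e₂,e₃] = −3e₃`, `[e₂,e₄] = −e₄`,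
every one-dimensional subspace is conjugate under a Lie algebra automorphism to one of
`span{e₄}`, `span{e₁}`, `span{e₃}`, `span{e₁ + e₃}`, `span{e₁ − e₃}`, `span{e₂}`. -/
theorem stmt_17 (L : Type*) [LieRing L] [LieAlgebra ℝ L]
    (e₁ e₂ e₃ e₄ : L) (hli : LinearIndependent ℝ ![e₁, e₂, e₃, e₄])
    (hspan : Submodule.span ℝ ({e₁, e₂, e₃, e₄} : Set L) = ⊤)
    (h12 : ⁅e₁, e₂⁆ = (-2 : ℝ) • e₁) (h13 : ⁅e₁, e₃⁆ = -e₄) (h14 : ⁅e₁, e₄⁆ = 0)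
    (h23 : ⁅e₂, e₃⁆ = (-3 : ℝ) • e₃) (h24 : ⁅e₂, e₄⁆ = -e₄) (h34 : ⁅e₃, e₄⁆ = 0) :
    ∀ W : L, W ≠ 0 → ∃ φ : L ≃ₗ⁅ℝ⁆ L,
      Submodule.map φ.toLieHom.toLinearMap (Submodule.span ℝ ({W} : Set L)) =
          Submodule.span ℝ ({e₄} : Set L) ∨
      Submodule.map φ.toLieHom.toLinearMap (Submodule.span ℝ ({W} : Set L)) =
          Submodule.span ℝ ({e₁} : Set L) ∨
      Submodule.map φ.toLieHom.toLinearMap (Submodule.span ℝ ({W} : Set L)) =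
          Submodule.span ℝ ({e₃} : Set L) ∨
      Submodule.map φ.toLieHom.toLinearMap (Submodule.span ℝ ({W} : Set L)) =
          Submodule.span ℝ ({e₁ + e₃} : Set L) ∨
      Submodule.map φ.toLieHom.toLinearMap (Submodule.span ℝ ({W} : Set L)) =
          Submodule.span ℝ ({e₁ - e₃} : Set L) ∨
      Submodule.map φ.toLieHom.toLinearMap (Submodule.span ℝ ({W} : Set L)) =
          Submodule.span ℝ ({e₂} : Set L) := by
  intro W hW
  have hspan' : ⊤ ≤ Submodule.span ℝ (Set.range ![e₁, e₂, e₃, e₄]) := by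
    rw [← hspan]
    refine Submodule.span_mono ?_
    simp [Set.insert_subset_iff]
  let b := Module.Basis.mk hli hspan'
  have b0 : b 0 = e₁ := Module.Basis.mk_apply hli hspan' 0
  have b1 : b 1 = e₂ := Module.Basis.mk_apply hli hspan' 1
  have b2 : b 2 = e₃ := Module.Basis.mk_apply hli hspan' 2
  have b3 : b 3 = e₄ := Module.Basis.mk_apply hli hspan' 3
  have hsum := b.sum_repr W
  rw [Fin.sum_univ_four, b0, b1, b2, b3] at hsum
  generalize b.repr W 0 = p, b.repr W 1 = q, b.repr W 2 = r, b.repr W 3 = s at hsum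
  have aut := @exists_lieEquiv L _ _ b
  rw [b0, b1, b2, b3] at aut
  replace aut := @aut h12 h13 h14 h23 h24 h34
  by_cases hq : q = 0
  · by_cases hp : p = 0
    · by_cases hr : r = 0
      · have hs : s ≠ 0 := by
          rintro rfl
          exact hW (by simp [← hsum, hp, hq, hr])
        obtain ⟨ψ, -, -, -, h⟩ := aut hs one_ne_zero 0 0 0
        refine ⟨ψ.symm, Or.inl (map_symm_span_singleton ψ one_ne_zero ?_)⟩
        rw [h, ← hsum, hp, hq, hr]
        module
      · obtain ⟨ψ, -, -, h, -⟩ := aut one_ne_zero hr (2 * s / r) 0 0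
        refine ⟨ψ.symm, Or.inr <| Or.inr <| Or.inl (map_symm_span_singleton ψ one_ne_zero ?_)⟩
        have hs : 2 * s / r * r / 2 = s := by field_simp
        rw [h, hs, ← hsum, hp, hq]
        module
    · have hs : 3 * s / p * p / 3 = s := by field_simp
      by_cases hr : r = 0
      · obtain ⟨ψ, h, -, -, -⟩ := aut hp one_ne_zero 0 (3 * s / p) 0
        refine ⟨ψ.symm, Or.inr <| Or.inl (map_symm_span_singleton ψ one_ne_zero ?_)⟩
        rw [h, hs, ← hsum, hq, hr]
        module
      · obtain ⟨ψ, h, -, h', -⟩ := aut hp hr 0 (3 * s / p) 0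
        refine ⟨ψ.symm, Or.inr <| Or.inr <| Or.inr <| Or.inl
          (map_symm_span_singleton ψ one_ne_zero ?_)⟩
        have hadd : ψ (e₁ + e₃) = ψ e₁ + ψ e₃ := map_add ψ.toLieHom _ _
        rw [hadd, h, h', hs, ← hsum, hq]
        module
  · obtain ⟨ψ, -, h, -, -⟩ := aut one_ne_zero one_ne_zero (q⁻¹ * p) (q⁻¹ * r) (q⁻¹ * s)
    refine ⟨ψ.symm, Or.inr <| Or.inr <| Or.inr <| Or.inr <| Or.inr
      (map_symm_span_singleton ψ (inv_ne_zero hq) ?_)⟩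
    rw [h, ← hsum]
    simp only [smul_add, smul_smul, inv_mul_cancel₀ hq]
    module
end
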